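/- arXiv:1101.0289 — 2 statements merged into one kernel-verified Lean document; each statement's English description precedes it below -/
import Mathlib

section
/- There is an effectively computable absolute constant 0 < c < 1 such that for every finite field F_q of odd characteristic p > 2, every multiplicative subgroup H of F_q^* of index m with m < c·√q, every integer k with 6·ln q < k ≤ (q−1)/(2m), and every b ∈ F_q, one has M_H(k,b) > 0. -/
/-- `MH H k b` is the number of `k`-element subsets `S` of the multiplicative
subgroup `H ⊆ Fˣ` (viewed inside `F`) with `∑_{a ∈ S} a = b`. -/
noncomputable def MH {F : Type*} [Field F] (H : Subgroup Fˣ) (k : ℕ) (b : F) : ℕ :=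
  Nat.card {S : Finset F //
    S.card = k ∧ (∀ x ∈ S, ∃ u : Fˣ, u ∈ H ∧ (u : F) = x) ∧ ∑ x ∈ S, x = b}

lemma norm_one_add_sq_le (w : ℂ) (r : ℝ) (hw : ‖w‖ = r) :
    ‖1 + w‖ ^ 2 ≤ (1 + r ^ 2) * Real.exp (2 * w.re / (1 + r ^ 2)) := by
  have hA : 0 < 1 + r ^ 2 := by positivity
  have h : ‖1 + w‖ ^ 2 = (1 + r ^ 2) * (2 * w.re / (1 + r ^ 2) + 1) := by
    rw [mul_add, mul_div_cancel₀ _ hA.ne', ← hw, Complex.sq_norm, Complex.sq_norm,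
      Complex.normSq_apply, Complex.normSq_apply]
    simp
    ring
  rw [h]
  gcongr
  exact Real.add_one_le_exp _

lemma norm_prod_one_add_sq_le {α : Type*} (T : Finset α) (z : α → ℂ) (t : ℂ) (D r : ℝ)
    (hz : ∀ x ∈ T, ‖z x‖ = 1) (hD : ‖∑ x ∈ T, z x‖ ≤ D) (ht : ‖t‖ = r) :
    ‖∏ x ∈ T, (1 + t * z x)‖ ^ 2 ≤
      (1 + r ^ 2) ^ T.card * Real.exp (2 * (r * D) / (1 + r ^ 2)) := by
  have hA : 0 < 1 + r ^ 2 := by positivity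
  rw [norm_prod, ← Finset.prod_pow]
  calc ∏ x ∈ T, ‖1 + t * z x‖ ^ 2
      ≤ ∏ x ∈ T, ((1 + r ^ 2) * Real.exp (2 * (t * z x).re / (1 + r ^ 2))) :=
        Finset.prod_le_prod (fun _ _ => by positivity) fun x hx =>
          norm_one_add_sq_le _ _ (by simp [hz x hx, ht])
    _ = (1 + r ^ 2) ^ T.card *
          Real.exp (2 * (t * ∑ x ∈ T, z x).re / (1 + r ^ 2)) := by
        rw [Finset.prod_mul_distrib, Finset.prod_const, ← Real.exp_sum, ← Finset.sum_div,
          ← Finset.mul_sum, ← Complex.re_sum, ← Finset.mul_sum]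
    _ ≤ _ := by
        gcongr
        refine (Complex.re_le_norm _).trans ?_
        rw [norm_mul, ht]
        have : 0 ≤ r := ht ▸ norm_nonneg t
        gcongr

lemma coeff_prod_one_add_C_mul_X {R α : Type*} [CommSemiring R] (T : Finset α) (c : α → R)
    (k : ℕ) :
    (∏ x ∈ T, (1 + Polynomial.C (c x) * Polynomial.X)).coeff k =
      ∑ S ∈ T.powersetCard k, ∏ x ∈ S, c x := by
  classical
  rw [Finset.prod_one_add, Polynomial.finsetSum_coeff, Finset.powersetCard_eq_filter,
    Finset.sum_filter]
  refine Finset.sum_congr rfl fun S _ => ?_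
  rw [Finset.prod_mul_distrib, Finset.prod_const, ← map_prod, Polynomial.coeff_C_mul,
    Polynomial.coeff_X_pow]
  simp [eq_comm]

lemma norm_coeff_sq_le {p : Polynomial ℂ} {B : ℝ} (hB : ∀ t : ℂ, ‖t‖ = 1 → ‖p.eval t‖ ^ 2 ≤ B)
    (k : ℕ) : ‖p.coeff k‖ ^ 2 ≤ B := by
  by_cases hk : p.coeff k = 0
  · rw [hk]
    simpa using (sq_nonneg _).trans (hB 1 (by simp))
  calc ‖p.coeff k‖ ^ 2 ≤ ∑ i ∈ p.support, ‖p.coeff i‖ ^ 2 :=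
        Finset.single_le_sum (f := fun i => ‖p.coeff i‖ ^ 2) (fun _ _ => by positivity)
          (Polynomial.mem_support_iff.2 hk)
    _ ≤ B := by
        rw [Polynomial.sum_sq_norm_coeff_eq_circleAverage]
        refine Real.circleAverage_mono_on_of_le_circle ?_ fun t ht => hB t (by simpa using ht)
        exact ContinuousOn.circleIntegrable' (by fun_prop)

lemma norm_sum_powersetCard_prod_sq_mul_le {α : Type*} (T : Finset α) (z : α → ℂ) (D r : ℝ)
    (hr : 0 ≤ r) (hz : ∀ x ∈ T, ‖z x‖ = 1) (hD : ‖∑ x ∈ T, z x‖ ≤ D) (k : ℕ) :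
    ‖∑ S ∈ T.powersetCard k, ∏ x ∈ S, z x‖ ^ 2 * (r ^ 2) ^ k ≤
      (1 + r ^ 2) ^ T.card * Real.exp (2 * (r * D) / (1 + r ^ 2)) := by
  have h := norm_coeff_sq_le
    (p := ∏ x ∈ T, (1 + Polynomial.C ((r : ℂ) * z x) * Polynomial.X))
    (B := (1 + r ^ 2) ^ T.card * Real.exp (2 * (r * D) / (1 + r ^ 2))) (fun t ht => by
      have := norm_prod_one_add_sq_le T z (t * r) D r hz hD (by simp [ht, abs_of_nonneg hr])
      rw [Polynomial.eval_prod]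
      convert this using 5
      simp
      ring) k
  refine le_of_eq_of_le ?_ h
  rw [coeff_prod_one_add_C_mul_X]
  have : ∀ S ∈ T.powersetCard k, ∏ x ∈ S, ((r : ℂ) * z x) = (r : ℂ) ^ k * ∏ x ∈ S, z x := by
    intro S hS
    rw [Finset.prod_mul_distrib, Finset.prod_const, (Finset.mem_powersetCard.1 hS).2]
  rw [Finset.sum_congr rfl this, ← Finset.mul_sum, norm_mul, mul_pow, norm_pow,
    Complex.norm_of_nonneg hr]
  ring

lemma choose_mul_pow_le_choose_mul_pow_of_le {n k j : ℕ} (hkn : k ≤ n) (hjk : j ≤ k) :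
    n.choose j * k ^ j * (n - k) ^ (n - j) ≤ n.choose k * k ^ k * (n - k) ^ (n - k) := by
  induction hjk using Nat.decreasingInduction with
  | self => rfl
  | of_succ i hi ih =>
    refine le_trans ?_ ih
    obtain ⟨d, rfl⟩ := Nat.exists_eq_add_of_le hkn
    have h1 : k + d - i = (k + d - (i + 1)) + 1 := by omega
    have h2 := Nat.choose_succ_right_eq (k + d) i
    rw [h1] at *
    generalize hm : k + d - (i + 1) = m at *
    have h3 : (i + 1) * d ≤ k * (m + 1) := by
      have : i + (m + 1) = k + d := by omega
      have : d ≤ m + 1 := by omega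
      nlinarith
    refine Nat.le_of_mul_le_mul_left ?_ (Nat.succ_pos i)
    simp only [Nat.add_sub_cancel_left]
    calc (i + 1) * ((k + d).choose i * k ^ i * d ^ (m + 1))
        = ((k + d).choose i * k ^ i * d ^ m) * ((i + 1) * d) := by ring
      _ ≤ ((k + d).choose i * k ^ i * d ^ m) * (k * (m + 1)) := by gcongr
      _ = ((k + d).choose i * (m + 1)) * (k ^ i * d ^ m * k) := by ring
      _ = (i + 1) * ((k + d).choose (i + 1) * k ^ (i + 1) * d ^ m) := by rw [← h2]; ring

lemma choose_mul_pow_le_choose_mul_pow {n k j : ℕ} (hkn : k ≤ n) (hjn : j ≤ n) :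
    n.choose j * k ^ j * (n - k) ^ (n - j) ≤ n.choose k * k ^ k * (n - k) ^ (n - k) := by
  rcases le_total j k with hjk | hjk
  · exact choose_mul_pow_le_choose_mul_pow_of_le hkn hjk
  · have h := choose_mul_pow_le_choose_mul_pow_of_le (Nat.sub_le n k) (Nat.sub_le_sub_left hjk n)
    rw [Nat.choose_symm hkn, Nat.choose_symm hjn, Nat.sub_sub_self hkn, Nat.sub_sub_self hjn] at h
    linarith

lemma one_add_pow_le_succ_mul_choose {n k : ℕ} (hkn : k < n) :
    (1 + (k : ℝ) / (n - k)) ^ n ≤ (n + 1) * n.choose k * ((k : ℝ) / (n - k)) ^ k := by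
  have hd : (0 : ℝ) < n - k := sub_pos.2 (by exact_mod_cast hkn)
  have h : ∀ j ∈ Finset.range (n + 1), (n.choose j : ℝ) * ((k : ℝ) / (n - k)) ^ j ≤
      n.choose k * ((k : ℝ) / (n - k)) ^ k := by
    intro j hj
    have hjn : j ≤ n := by simpa [Nat.lt_succ_iff] using hj
    have := choose_mul_pow_le_choose_mul_pow hkn.le hjn
    have h' : (n.choose j : ℝ) * k ^ j * (n - k) ^ (n - j) ≤
        n.choose k * k ^ k * (n - k) ^ (n - k) := by
      rw [← Nat.cast_sub hkn.le]; exact_mod_cast this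
    rw [div_pow, div_pow, mul_div_assoc', mul_div_assoc',
      div_le_div_iff₀ (by positivity) (by positivity)]
    have e1 : ((n : ℝ) - k) ^ n = (n - k) ^ (n - j) * (n - k) ^ j := by
      rw [← pow_add]; congr 1; omega
    have e2 : ((n : ℝ) - k) ^ n = (n - k) ^ (n - k) * (n - k) ^ k := by
      rw [← pow_add]; congr 1; omega
    refine le_of_mul_le_mul_right ?_ (show (0 : ℝ) < (n - k) ^ n by positivity)
    calc _ = (n.choose j : ℝ) * k ^ j * (n - k) ^ k * ((n - k) ^ (n - j) * (n - k) ^ j) := by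
          rw [← e1]
      _ = (n.choose j : ℝ) * k ^ j * (n - k) ^ (n - j) * ((n - k) ^ j * (n - k) ^ k) := by ring
      _ ≤ n.choose k * k ^ k * (n - k) ^ (n - k) * ((n - k) ^ j * (n - k) ^ k) := by gcongr
      _ = n.choose k * k ^ k * (n - k) ^ j * ((n - k) ^ (n - k) * (n - k) ^ k) := by ring
      _ = _ := by rw [← e2]
  rw [add_comm, add_pow]
  calc _ = ∑ j ∈ Finset.range (n + 1), (n.choose j : ℝ) * ((k : ℝ) / (n - k)) ^ j :=
        Finset.sum_congr rfl fun _ _ => by ring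
    _ ≤ ∑ j ∈ Finset.range (n + 1), (n.choose k : ℝ) * ((k : ℝ) / (n - k)) ^ k :=
        Finset.sum_le_sum h
    _ = _ := by simp; ring

lemma div_pow_le_choose {n k : ℕ} (hkn : k ≤ n) : ((n : ℝ) / k) ^ k ≤ n.choose k := by
  induction k generalizing n with
  | zero => simp
  | succ k ih =>
    obtain ⟨n, rfl⟩ : ∃ m, n = m + 1 := ⟨n - 1, by omega⟩
    have hk : k ≤ n := by omega
    have h1 : ((n + 1 : ℕ) : ℝ) * n.choose k = (n + 1).choose (k + 1) * (k + 1 : ℕ) := by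
      exact_mod_cast Nat.add_one_mul_choose_eq n k
    have hc : ((n + 1).choose (k + 1) : ℝ) = ((n + 1 : ℕ) : ℝ) / (k + 1 : ℕ) * n.choose k := by
      field_simp
      linarith
    rw [hc, pow_succ']
    gcongr
    rcases Nat.eq_zero_or_pos k with rfl | hk0
    · simp
    refine le_trans ?_ (ih hk)
    gcongr ?_ ^ k
    have : (0 : ℝ) < k := by exact_mod_cast hk0
    have : (k : ℝ) ≤ n := by exact_mod_cast hk
    rw [div_le_div_iff₀ (by positivity) (by positivity)]
    push_cast
    nlinarith

section CharacterSums

variable {F : Type*} [Field F] [Fintype F]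

/-- The subgroup `H ≤ Fˣ`, as a finite set of elements of `F`. -/
noncomputable def subgroupFinset (H : Subgroup Fˣ) : Finset F :=
  letI := Fintype.ofFinite H
  Finset.univ.map ⟨fun u : H => ((u : Fˣ) : F), Units.val_injective.comp Subtype.val_injective⟩

lemma mem_subgroupFinset {H : Subgroup Fˣ} {x : F} :
    x ∈ subgroupFinset H ↔ ∃ u : Fˣ, u ∈ H ∧ (u : F) = x := by
  simp [subgroupFinset]

lemma card_subgroupFinset_mul_index (H : Subgroup Fˣ) :
    (subgroupFinset H).card * H.index = Fintype.card F - 1 := by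
  let := Fintype.ofFinite H
  rw [← Nat.card_eq_fintype_card, ← Nat.card_units, ← H.card_mul_index, subgroupFinset,
    Finset.card_map, Finset.card_univ, Nat.card_eq_fintype_card]

lemma sum_subgroupFinset_mul_left {M : Type*} [AddCommMonoid M] (H : Subgroup Fˣ) {h : F}
    (hh : h ∈ subgroupFinset H) (g : F → M) :
    ∑ x ∈ subgroupFinset H, g (h * x) = ∑ x ∈ subgroupFinset H, g x := by
  obtain ⟨u, hu, rfl⟩ := mem_subgroupFinset.1 hh
  let := Fintype.ofFinite H
  simp only [subgroupFinset, Finset.sum_map, Function.Embedding.coeFn_mk]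
  exact Fintype.sum_equiv (Equiv.mulLeft (⟨u, hu⟩ : H)) _ _ fun v => by simp

lemma sum_norm_sum_addChar_sq {ψ : AddChar F ℂ} (hψ : ψ.IsPrimitive) (T : Finset F) :
    ∑ a : F, ‖∑ x ∈ T, ψ (a * x)‖ ^ 2 = Fintype.card F * T.card := by
  classical
  have h : ∀ a : F, ((‖∑ x ∈ T, ψ (a * x)‖ ^ 2 : ℝ) : ℂ) =
      ∑ x ∈ T, ∑ y ∈ T, ψ (a * (x - y)) := by
    intro a
    rw [Complex.ofReal_pow, ← Complex.mul_conj', map_sum, Finset.sum_mul_sum]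
    refine Finset.sum_congr rfl fun x _ => Finset.sum_congr rfl fun y _ => ?_
    rw [← AddChar.map_neg_eq_conj, ← AddChar.map_add_eq_mul]
    congr 1
    ring
  have : ((∑ a : F, ‖∑ x ∈ T, ψ (a * x)‖ ^ 2 : ℝ) : ℂ) = Fintype.card F * T.card := by
    rw [Complex.ofReal_sum, Finset.sum_congr rfl fun a _ => h a, Finset.sum_comm]
    have : ∀ x ∈ T, ∑ a : F, ∑ y ∈ T, ψ (a * (x - y)) = Fintype.card F := by
      intro x hx
      rw [Finset.sum_comm]
      simp [AddChar.sum_mulShift _ hψ, sub_eq_zero, hx]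
    rw [Finset.sum_congr rfl this]
    simp [mul_comm]
  exact_mod_cast this

lemma norm_sum_subgroupFinset_addChar_le {ψ : AddChar F ℂ} (hψ : ψ.IsPrimitive)
    (H : Subgroup Fˣ) {a : F} (ha : a ≠ 0) :
    ‖∑ x ∈ subgroupFinset H, ψ (a * x)‖ ≤ Real.sqrt (Fintype.card F) := by
  classical
  refine Real.le_sqrt_of_sq_le ?_
  have hpos : (0 : ℝ) < (subgroupFinset H).card := by
    exact_mod_cast Finset.card_pos.2 ⟨1, mem_subgroupFinset.2 ⟨1, H.one_mem, rfl⟩⟩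
  refine le_of_mul_le_mul_right ?_ hpos
  rw [← sum_norm_sum_addChar_sq hψ]
  calc _ = ∑ h ∈ subgroupFinset H, ‖∑ x ∈ subgroupFinset H, ψ (a * h * x)‖ ^ 2 := by
        rw [mul_comm, ← nsmul_eq_mul, ← Finset.sum_const]
        refine Finset.sum_congr rfl fun h hh => ?_
        rw [← sum_subgroupFinset_mul_left H hh fun x => ψ (a * x)]
        simp only [mul_assoc]
    _ = ∑ b ∈ (subgroupFinset H).map ⟨(a * ·), mul_right_injective₀ ha⟩,
          ‖∑ x ∈ subgroupFinset H, ψ (b * x)‖ ^ 2 := by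
        rw [Finset.sum_map]; rfl
    _ ≤ _ := Finset.sum_le_sum_of_subset_of_nonneg (Finset.subset_univ _)
        fun _ _ _ => by positivity

lemma MH_eq_card_filter [DecidableEq F] (H : Subgroup Fˣ) (k : ℕ) (b : F) :
    MH H k b = (((subgroupFinset H).powersetCard k).filter fun S => ∑ x ∈ S, x = b).card := by
  refine Nat.subtype_card _ fun S => ?_
  simp only [Finset.mem_filter, Finset.mem_powersetCard, Finset.subset_iff, mem_subgroupFinset]
  tauto

lemma card_mul_MH {ψ : AddChar F ℂ} (hψ : ψ.IsPrimitive) (H : Subgroup Fˣ) (k : ℕ) (b : F) :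
    (Fintype.card F * MH H k b : ℂ) =
      ∑ a : F, ψ (-(a * b)) * ∑ S ∈ (subgroupFinset H).powersetCard k, ∏ x ∈ S, ψ (a * x) := by
  classical
  have ψ_prod (a : F) (S : Finset F) : ∏ x ∈ S, ψ (a * x) = ψ (∑ x ∈ S, a * x) := by
    induction S using Finset.induction_on with
    | empty => simp
    | insert x S hx ih => rw [Finset.prod_insert hx, Finset.sum_insert hx, ih, ψ.map_add_eq_mul]
  have h : ∀ a : F, ψ (-(a * b)) * ∑ S ∈ (subgroupFinset H).powersetCard k,
      ∏ x ∈ S, ψ (a * x) =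
      ∑ S ∈ (subgroupFinset H).powersetCard k, ψ (a * (∑ x ∈ S, x - b)) := by
    intro a
    rw [Finset.mul_sum]
    refine Finset.sum_congr rfl fun S _ => ?_
    rw [ψ_prod, ← AddChar.map_add_eq_mul, ← Finset.mul_sum]
    congr 1
    ring
  rw [Finset.sum_congr rfl fun a _ => h a, Finset.sum_comm, MH_eq_card_filter,
    Finset.card_filter]
  simp only [AddChar.sum_mulShift _ hψ, sub_eq_zero]
  rw [Nat.cast_sum, Finset.mul_sum]
  exact Finset.sum_congr rfl fun S _ => by split_ifs <;> simp

lemma MH_pos_of_norm_lt {ψ : AddChar F ℂ} (hψ : ψ.IsPrimitive) (H : Subgroup Fˣ) (k : ℕ) (b : F)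
    (h : ∀ a : F, a ≠ 0 → Fintype.card F *
      ‖∑ S ∈ (subgroupFinset H).powersetCard k, ∏ x ∈ S, ψ (a * x)‖ <
        (subgroupFinset H).card.choose k) :
    0 < MH H k b := by
  classical
  rw [Nat.pos_iff_ne_zero]
  intro h0
  have hsum := card_mul_MH hψ H k b
  rw [h0, Nat.cast_zero, mul_zero, ← Finset.add_sum_erase _ _ (Finset.mem_univ (0 : F))] at hsum
  simp only [zero_mul, neg_zero, AddChar.map_zero_eq_one, Finset.prod_const_one, one_mul,
    Finset.sum_const, Finset.card_powersetCard, nsmul_eq_mul, mul_one] at hsum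
  have hq : (0 : ℝ) < Fintype.card F := by exact_mod_cast Fintype.card_pos
  have hle : ((subgroupFinset H).card.choose k : ℝ) ≤ ∑ a ∈ Finset.univ.erase (0 : F),
      ‖∑ S ∈ (subgroupFinset H).powersetCard k, ∏ x ∈ S, ψ (a * x)‖ := by
    have h1 := eq_neg_of_add_eq_zero_left hsum.symm
    have h2 := congrArg norm h1
    rw [norm_neg, Complex.norm_natCast] at h2
    rw [h2]
    exact (norm_sum_le _ _).trans (Finset.sum_le_sum fun a _ => by simp)
  have hlt : ∑ a ∈ Finset.univ.erase (0 : F),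
      ‖∑ S ∈ (subgroupFinset H).powersetCard k, ∏ x ∈ S, ψ (a * x)‖ <
      Fintype.card F * (((subgroupFinset H).card.choose k : ℝ) / Fintype.card F) := by
    calc _ < ∑ a ∈ Finset.univ.erase (0 : F),
            ((subgroupFinset H).card.choose k : ℝ) / Fintype.card F := by
          refine Finset.sum_lt_sum_of_nonempty ⟨1, by simp⟩ fun a ha => ?_
          rw [lt_div_iff₀' hq]
          exact h a (Finset.ne_of_mem_erase ha)
      _ ≤ _ := by
          rw [Finset.sum_const, nsmul_eq_mul]
          gcongr
          exact Finset.card_le_univ _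
  rw [mul_div_cancel₀ _ hq.ne'] at hlt
  exact absurd hle hlt.not_ge

end CharacterSums

lemma mul_lt_choose_of_small {n k : ℕ} {q D E : ℝ} (hk : 0 < k) (hkn : k ≤ n) (hD : 0 < D)
    (hE : 0 ≤ E) (hsmall : k * n ≤ 16 * D ^ 2) (hDn : D * Real.exp 10 ≤ n)
    (hq : q < Real.exp (k / 6)) (hq0 : 0 < q)
    (h : ∀ r : ℝ, 0 ≤ r → E ^ 2 * (r ^ 2) ^ k ≤
      (1 + r ^ 2) ^ n * Real.exp (2 * (r * D) / (1 + r ^ 2))) :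
    q * E < n.choose k := by
  have hk' : (0 : ℝ) < k := by exact_mod_cast hk
  have hn' : (0 : ℝ) < n := by exact_mod_cast hk.trans_le hkn
  have hr := h (k / D) (by positivity)
  have hbound : (E * (k / D) ^ k) ^ 2 ≤ Real.exp (9 * k) ^ 2 := by
    calc (E * (k / D) ^ k) ^ 2 = E ^ 2 * ((k / D) ^ 2) ^ k := by
          rw [mul_pow, ← pow_mul, ← pow_mul, mul_comm k 2]
      _ ≤ _ := hr
      _ ≤ Real.exp (16 * k) * Real.exp (2 * k) := by
          gcongr
          · calc (1 + (k / D) ^ 2) ^ n ≤ Real.exp ((k / D) ^ 2) ^ n := by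
                  gcongr
                  rw [add_comm]; exact Real.add_one_le_exp _
              _ = Real.exp (n * (k / D) ^ 2) := by rw [← Real.exp_nat_mul]
              _ ≤ _ := by
                  refine Real.exp_le_exp.2 ?_
                  rw [div_pow, mul_div_assoc', div_le_iff₀ (by positivity)]
                  nlinarith
          · rw [div_mul_cancel₀ _ hD.ne', div_le_iff₀ (by positivity)]
            have : 0 ≤ (k / D) ^ 2 := by positivity
            nlinarith
      _ = _ := by rw [← Real.exp_add, ← Real.exp_nat_mul]; congr 1; push_cast; ring
  have hb := (sq_le_sq₀ (by positivity) (by positivity)).1 hbound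
  have hED : E ≤ Real.exp (9 * k) * (D / k) ^ k := by
    rw [← le_div_iff₀ (by positivity)] at hb
    refine hb.trans_eq ?_
    rw [div_eq_mul_inv, ← inv_pow, inv_div]
  refine lt_of_lt_of_le ?_ (div_pow_le_choose hkn)
  calc q * E ≤ q * (Real.exp (9 * k) * (D / k) ^ k) := by gcongr
    _ < Real.exp (k / 6) * (Real.exp (9 * k) * (D / k) ^ k) := by gcongr
    _ ≤ Real.exp (k * 10) * (D / k) ^ k := by
        rw [← mul_assoc, ← Real.exp_add]
        gcongr
        linarith
    _ = (D * Real.exp 10 / k) ^ k := by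
        rw [Real.exp_nat_mul, ← mul_pow]; congr 1; ring
    _ ≤ _ := by gcongr

lemma mul_lt_choose_of_large {n k : ℕ} {q D E : ℝ} (hk : 0 < k) (hkn : 2 * k ≤ n)
    (hlarge : 16 * D ^ 2 ≤ k * n) (hnq : (n : ℝ) + 1 ≤ q)
    (hq : q < Real.exp (k / 6))
    (h : ∀ r : ℝ, 0 ≤ r → E ^ 2 * (r ^ 2) ^ k ≤
      (1 + r ^ 2) ^ n * Real.exp (2 * (r * D) / (1 + r ^ 2))) :
    q * E < n.choose k := by
  have hk' : (0 : ℝ) < k := by exact_mod_cast hk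
  have hkn' : (2 * k : ℝ) ≤ n := by exact_mod_cast hkn
  have hq0 : 0 < q := by linarith
  have hn0 : (0 : ℝ) < n := by linarith
  set s : ℝ := k / (n - k) with hs
  have hd : (0 : ℝ) < n - k := by linarith
  have hs0 : 0 < s := by positivity
  have hs1 : 1 + s = n / (n - k) := by rw [hs]; field_simp; ring
  have hsn : s * (n - k) = k := by rw [hs]; field_simp
  have hr := h (Real.sqrt s) (Real.sqrt_nonneg s)
  rw [Real.sq_sqrt hs0.le] at hr
  have hloss : 2 * (Real.sqrt s * D) / (1 + s) ≤ k / 2 := by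
    have : Real.sqrt s * D / (1 + s) ≤ k / 4 := by
      refine le_of_sq_le_sq ?_ (by positivity)
      rw [div_pow, mul_pow, Real.sq_sqrt hs0.le, hs1, hs]
      rw [div_le_iff₀ (by positivity), div_pow]
      have : D ^ 2 ≤ k * n / 16 := by linarith
      calc k / (n - k) * D ^ 2 ≤ k / (n - k) * (k * n / 16) := by gcongr
        _ ≤ k / (n - k) * (k * n / 16) * (n / (n - k)) := by
            refine le_mul_of_one_le_right (by positivity) ?_
            rw [one_le_div hd]; linarith
        _ = _ := by field_simp; ring
    rw [mul_div_assoc]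
    linarith
  have hX4 : 4 ^ k * s ^ k ≤ (1 + s) ^ n := by
    calc 4 ^ k * s ^ k = (4 * s) ^ k := by rw [mul_pow]
      _ ≤ ((1 + s) ^ 2) ^ k := by gcongr; nlinarith [sq_nonneg (1 - s)]
      _ = (1 + s) ^ (2 * k) := by rw [pow_mul]
      _ ≤ _ := pow_le_pow_right₀ (by linarith) hkn
  have hXC : (1 + s) ^ n ≤ q * n.choose k * s ^ k :=
    (one_add_pow_le_succ_mul_choose (by omega)).trans (by gcongr)
  have hE2 : E ^ 2 * s ^ k ≤ (1 + s) ^ n * Real.exp (k / 2) := hr.trans (by gcongr)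
  have hexp : q ^ 4 * Real.exp (k / 2) < 4 ^ k := by
    calc q ^ 4 * Real.exp (k / 2) < Real.exp (k / 6) ^ 4 * Real.exp (k / 2) := by gcongr
      _ = Real.exp (k * (7 / 6)) := by
          rw [← Real.exp_nat_mul, ← Real.exp_add]; congr 1; push_cast; ring
      _ = Real.exp (7 / 6) ^ k := by rw [Real.exp_nat_mul]
      _ ≤ _ := by
          gcongr
          rw [← Real.le_log_iff_exp_le (by norm_num), show (4 : ℝ) = 2 ^ 2 by norm_num,
            Real.log_pow]
          have := Real.log_two_gt_d9
          push_cast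
          linarith
  have hC0 : (0 : ℝ) < n.choose k := by exact_mod_cast Nat.choose_pos (by omega)
  refine lt_of_pow_lt_pow_left₀ 2 hC0.le ?_
  have hs2 : 0 < s ^ k := by positivity
  set X := (1 + s) ^ n
  have hX0 : 0 < X := by positivity
  refine lt_of_mul_lt_mul_right ?_ (show 0 ≤ q ^ 2 * (s ^ k) ^ 2 by positivity)
  calc (q * E) ^ 2 * (q ^ 2 * (s ^ k) ^ 2) = q ^ 4 * s ^ k * (E ^ 2 * s ^ k) := by ring
    _ ≤ q ^ 4 * s ^ k * (X * Real.exp (k / 2)) := by gcongr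
    _ = (q ^ 4 * Real.exp (k / 2)) * (s ^ k * X) := by ring
    _ < 4 ^ k * (s ^ k * X) := by gcongr
    _ = (4 ^ k * s ^ k) * X := by ring
    _ ≤ X * X := by gcongr
    _ ≤ (q * n.choose k * s ^ k) * (q * n.choose k * s ^ k) := by gcongr
    _ = _ := by ring

theorem exists_constant_subset_sum_subgroup_positive :
    ∃ c : ℝ, 0 < c ∧ c < 1 ∧
      ∀ (F : Type) [Field F] [Fintype F], 2 < ringChar F →
        ∀ (H : Subgroup Fˣ) (k : ℕ) (b : F),
          (H.index : ℝ) < c * Real.sqrt (Fintype.card F) →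
          6 * Real.log (Fintype.card F) < (k : ℝ) →
          (k : ℝ) ≤ ((Fintype.card F : ℝ) - 1) / (2 * H.index) →
          0 < MH H k b := by
  refine ⟨Real.exp (-12), Real.exp_pos _, by simp, ?_⟩
  intro F _ _ _ H k b hm hk hkm
  have hψ := AddChar.FiniteField.primitiveChar_to_Complex_isPrimitive F
  have hqnat : 2 ≤ Fintype.card F := Fintype.one_lt_card
  have hnm : ((subgroupFinset H).card : ℝ) * H.index = Fintype.card F - 1 := by
    rw [← Nat.cast_one, ← Nat.cast_sub (by omega)]
    exact_mod_cast card_subgroupFinset_mul_index H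
  have hm1 : (1 : ℝ) ≤ H.index := by
    exact_mod_cast Nat.one_le_iff_ne_zero.2 Subgroup.index_ne_zero_of_finite
  refine MH_pos_of_norm_lt hψ H k b fun a ha => ?_
  have hbound := fun r hr => norm_sum_powersetCard_prod_sq_mul_le (subgroupFinset H)
    (fun x => AddChar.FiniteField.primitiveChar_to_Complex F (a * x))
    _ r hr (fun x _ => AddChar.norm_apply _ _) (norm_sum_subgroupFinset_addChar_le hψ H ha) k
  generalize (subgroupFinset H).card = n at *
  have hq2 : (2 : ℝ) ≤ Fintype.card F := by exact_mod_cast hqnat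
  generalize (Fintype.card F : ℝ) = q at *
  have hq0 : 0 < q := by linarith
  have hk0 : 0 < k := by
    have : (0 : ℝ) < k := (mul_nonneg (by norm_num) (Real.log_nonneg (by linarith))).trans_lt hk
    exact_mod_cast this
  have hD := Real.sqrt_pos.2 hq0
  have hD2 := Real.sq_sqrt hq0.le
  have hkn : 2 * k ≤ n := by
    rw [le_div_iff₀ (by positivity), ← hnm] at hkm
    have : (2 * k : ℝ) ≤ n := by
      refine le_of_mul_le_mul_right ?_ (zero_lt_one.trans_le hm1)
      linarith
    exact_mod_cast this
  have hq : q < Real.exp (k / 6) := by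
    rw [← Real.log_lt_iff_lt_exp hq0]
    linarith
  rcases le_total ((k : ℝ) * n) (16 * Real.sqrt q ^ 2) with h | h
  · refine mul_lt_choose_of_small hk0 (by omega) hD (norm_nonneg _) h ?_ hq hq0 hbound
    refine le_of_mul_le_mul_right ?_ (zero_lt_one.trans_le hm1)
    have he : Real.exp 10 * Real.exp (-12) ≤ 1 / 2 := by
      rw [← Real.exp_add, show (10 : ℝ) + -12 = -2 by norm_num, Real.exp_neg, one_div]
      gcongr
      linarith [Real.add_one_le_exp (2 : ℝ)]
    calc Real.sqrt q * Real.exp 10 * H.index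
        ≤ Real.sqrt q * Real.exp 10 * (Real.exp (-12) * Real.sqrt q) := by gcongr
      _ = Real.exp 10 * Real.exp (-12) * q := by rw [← hD2]; ring_nf; simp [hq0.le]
      _ ≤ 1 / 2 * q := by gcongr
      _ ≤ n * H.index := by linarith
  · refine mul_lt_choose_of_large hk0 hkn h ?_ hq hbound
    nlinarith [(Nat.cast_nonneg n : (0 : ℝ) ≤ n)]
end

section
/- There is an effectively computable absolute constant 0 < c < 1 such that for every finite field F_q of odd characteristic p > 2, every positive divisor m of q−1 with m < c·√q, every integer k with 6·ln q < k ≤ (q−1)/2, and every b ∈ F_q, one has N_m^*(k,b) > 0. -/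
/-- `Nstar m k b` is the number of ordered `k`-tuples of pairwise distinct nonzero
elements `x₁, …, x_k` of `F` with `x₁^m + ⋯ + x_k^m = b`. -/
noncomputable def Nstar {F : Type*} [Field F] (m k : ℕ) (b : F) : ℕ :=
  Nat.card {x : Fin k → F //
    Function.Injective x ∧ (∀ i, x i ≠ 0) ∧ ∑ i, x i ^ m = b}

open Polynomial in
/-- A coefficient of a complex polynomial is at most its maximum on the unit circle. -/
theorem norm_coeff_le_of_forall_norm_eval_le (p : ℂ[X]) {M : ℝ}
    (h : ∀ z : ℂ, ‖z‖ = 1 → ‖p.eval z‖ ≤ M) (k : ℕ) : ‖p.coeff k‖ ≤ M := by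
  have hM : 0 ≤ M := (norm_nonneg _).trans (h 1 (by simp))
  by_cases hk : k ∈ p.support
  · have hsum := p.sum_sq_norm_coeff_eq_circleAverage
    have hle : Real.circleAverage (fun z ↦ ‖p.eval z‖ ^ 2) 0 1 ≤ M ^ 2 := by
      apply Real.circleAverage_mono_on_of_le_circle
      · apply ContinuousOn.circleIntegrable'
        fun_prop
      · intro z hz
        have hz1 : ‖z‖ = 1 := by simpa using hz
        gcongr
        exact h z hz1
    have hterm : ‖p.coeff k‖ ^ 2 ≤ ∑ i ∈ p.support, ‖p.coeff i‖ ^ 2 :=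
      Finset.single_le_sum (f := fun i ↦ ‖p.coeff i‖ ^ 2) (fun i _ ↦ by positivity) hk
    exact le_of_sq_le_sq (hterm.trans (hsum.le.trans hle)) hM
  · rw [notMem_support_iff.mp hk]
    simpa using hM

/-- An elementary symmetric function of complex numbers of modulus one is bounded in terms of
their sum. -/
theorem norm_sum_powersetCard_prod_mul_pow_le {ι : Type*} (s : Finset ι) (f : ι → ℂ)
    (hf : ∀ x ∈ s, ‖f x‖ = 1) {B : ℝ} (hB : ‖∑ x ∈ s, f x‖ ≤ B) {r : ℝ} (hr : 0 ≤ r) (k : ℕ) :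
    ‖∑ t ∈ s.powersetCard k, ∏ x ∈ t, f x‖ * r ^ k
      ≤ Real.exp ((s.card * r ^ 2 + 2 * r * B) / 2) := by
  classical
  set p : Polynomial ℂ := ∏ x ∈ s, (1 + Polynomial.C (r * f x) * Polynomial.X) with hp
  have hcoeff : p.coeff k = (∑ t ∈ s.powersetCard k, ∏ x ∈ t, f x) * r ^ k := by
    rw [hp, Finset.prod_one_add, Polynomial.finsetSum_coeff, Finset.powersetCard_eq_filter,
      Finset.sum_filter, Finset.sum_mul]
    refine Finset.sum_congr rfl fun t _ ↦ ?_
    rw [Finset.prod_mul_distrib, Finset.prod_const, ← map_prod, Polynomial.coeff_C_mul_X_pow,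
      Finset.prod_mul_distrib, Finset.prod_const]
    by_cases h : t.card = k
    · simp [h, mul_comm]
    · simp [h, Ne.symm h]
  have hbound := norm_coeff_le_of_forall_norm_eval_le p
    (M := Real.exp ((s.card * r ^ 2 + 2 * r * B) / 2)) (fun z hz ↦ ?_) k
  · rw [hcoeff, norm_mul, norm_pow, Complex.norm_real, Real.norm_of_nonneg hr] at hbound
    exact hbound
  · have hsq : ‖p.eval z‖ ^ 2 ≤ Real.exp ((s.card * r ^ 2 + 2 * r * B) / 2) ^ 2 := by
      rw [← Real.exp_nat_mul, hp, Polynomial.eval_prod, norm_prod, ← Finset.prod_pow]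
      have hfac : ∀ x ∈ s, ‖(1 + Polynomial.C (r * f x) * Polynomial.X).eval z‖ ^ 2
          = 1 + (r ^ 2 + 2 * r * (f x * z).re) := by
        intro x hx
        have h1 : ‖f x * z‖ ^ 2 = 1 := by rw [norm_mul, hf x hx, hz]; norm_num
        have h2 : (1 + Polynomial.C (r * f x) * Polynomial.X).eval z = 1 + r * (f x * z) := by
          simp; ring
        rw [h2]
        rw [← Complex.normSq_eq_norm_sq, Complex.normSq_apply] at h1 ⊢
        simp only [Complex.add_re, Complex.one_re, Complex.re_ofReal_mul, Complex.add_im,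
          Complex.one_im, Complex.im_ofReal_mul]
        linear_combination r ^ 2 * h1
      rw [Finset.prod_congr rfl hfac]
      refine (Finset.prod_le_prod (fun x hx ↦ ?_) fun x hx ↦ ?_).trans
        ((Real.exp_sum s fun x ↦ r ^ 2 + 2 * r * (f x * z).re).ge.trans ?_)
      · rw [← hfac x hx]; positivity
      · rw [add_comm]; exact Real.add_one_le_exp _
      · refine Real.exp_le_exp.mpr ?_
        have hre : ∑ x ∈ s, (f x * z).re ≤ B := by
          rw [← Complex.re_sum, ← Finset.sum_mul]
          refine (Complex.re_le_norm _).trans ?_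
          rwa [norm_mul, hz, mul_one]
        rw [Finset.sum_add_distrib, ← Finset.mul_sum, Finset.sum_const, nsmul_eq_mul]
        have := mul_le_mul_of_nonneg_left hre (by positivity : 0 ≤ 2 * r)
        push_cast
        linarith
    exact le_of_sq_le_sq hsq (Real.exp_nonneg _)

/-- A unit of a finite field has at most `m` roots of order `m`. -/
theorem card_units_pow_eq_le {F : Type*} [Field F] [Fintype F] [DecidableEq F] {m : ℕ}
    (hm : 0 < m) (w : F) :
    (Finset.univ.filter fun z : Fˣ ↦ (z : F) ^ m = w).card ≤ m := by
  calc _ ≤ (Polynomial.nthRoots m w).toFinset.card := by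
        refine Finset.card_le_card_of_injOn (fun z ↦ (z : F)) (fun z hz ↦ ?_)
          (Units.val_injective.injOn)
        simpa [Polynomial.mem_nthRoots hm] using hz
    _ ≤ _ := (Multiset.toFinset_card_le _).trans (Polynomial.card_nthRoots m w)

/-- The second moment of the monomial character sums. -/
theorem sum_norm_sq_sum_units_pow_le {F : Type*} [Field F] [Fintype F] [DecidableEq F]
    {ψ : AddChar F ℂ} (hψ : ψ.IsPrimitive) {m : ℕ} (hm : 0 < m) :
    ∑ b : F, ‖∑ x : Fˣ, ψ (b * (x : F) ^ m)‖ ^ 2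
      ≤ (Fintype.card F : ℝ) * (Fintype.card Fˣ * m) := by
  have key : ((∑ b : F, ‖∑ x : Fˣ, ψ (b * (x : F) ^ m)‖ ^ 2 : ℝ) : ℂ)
      = ((∑ y : Fˣ, (Fintype.card F : ℝ) *
          (Finset.univ.filter fun x : Fˣ ↦ (x : F) ^ m = (y : F) ^ m).card : ℝ) : ℂ) := by
    push_cast
    calc _ = ∑ b : F, ∑ y : Fˣ, ∑ x : Fˣ, ψ (b * ((x : F) ^ m - (y : F) ^ m)) := by
          refine Finset.sum_congr rfl fun b _ ↦ ?_
          rw [← Complex.mul_conj', map_sum, Finset.mul_sum]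
          refine Finset.sum_congr rfl fun y _ ↦ ?_
          rw [Finset.sum_mul]
          refine Finset.sum_congr rfl fun x _ ↦ ?_
          rw [← AddChar.map_neg_eq_conj, ← AddChar.map_add_eq_mul]
          congr 1
          ring
      _ = ∑ y : Fˣ, ∑ x : Fˣ, ∑ b : F, ψ (b * ((x : F) ^ m - (y : F) ^ m)) := by
          rw [Finset.sum_comm]
          exact Finset.sum_congr rfl fun y _ ↦ Finset.sum_comm
      _ = _ := by
          refine Finset.sum_congr rfl fun y _ ↦ ?_
          simp_rw [AddChar.sum_mulShift _ hψ, sub_eq_zero]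
          simp [← Finset.sum_filter, mul_comm]
  rw [Complex.ofReal_inj.mp key, ← Finset.mul_sum]
  gcongr
  calc _ ≤ ∑ _y : Fˣ, (m : ℝ) :=
        Finset.sum_le_sum fun y _ ↦ Nat.cast_le.mpr (card_units_pow_eq_le hm _)
    _ = _ := by simp

/-- The Weil bound for monomials, by averaging over the `m`-th powers. -/
theorem norm_sum_units_pow_le {F : Type*} [Field F] [Fintype F] [DecidableEq F]
    {ψ : AddChar F ℂ} (hψ : ψ.IsPrimitive) {m : ℕ} (hm : 0 < m) {a : F} (ha : a ≠ 0) :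
    ‖∑ x : Fˣ, ψ (a * (x : F) ^ m)‖ ≤ m * √(Fintype.card F) := by
  set g : F → ℝ := fun b ↦ ‖∑ x : Fˣ, ψ (b * (x : F) ^ m)‖ ^ 2 with hg
  have hinv : ∀ z : Fˣ, g (a * (z : F) ^ m) = g a := by
    intro z
    simp only [hg]
    congr 2
    refine Fintype.sum_equiv (Equiv.mulLeft z) _ _ fun x ↦ ?_
    simp [mul_pow, mul_assoc]
  have hsum : (Fintype.card Fˣ : ℝ) * g a ≤ m * ∑ b : F, g b := by
    calc (Fintype.card Fˣ : ℝ) * g a = ∑ z : Fˣ, g (a * (z : F) ^ m) := by simp [hinv]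
      _ = ∑ b : F, ∑ z ∈ Finset.univ.filter (fun z : Fˣ ↦ a * (z : F) ^ m = b),
            g (a * (z : F) ^ m) :=
          (Finset.sum_fiberwise Finset.univ (fun z : Fˣ ↦ a * (z : F) ^ m) _).symm
      _ ≤ ∑ b : F, m * g b := by
          refine Finset.sum_le_sum fun b _ ↦ ?_
          rw [Finset.sum_congr rfl (g := fun _ ↦ g b)
            (fun z hz ↦ by rw [(Finset.mem_filter.mp hz).2]), Finset.sum_const, nsmul_eq_mul]
          have hcard : (Finset.univ.filter fun z : Fˣ ↦ a * (z : F) ^ m = b).card ≤ m := by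
            simp_rw [← eq_inv_mul_iff_mul_eq₀ ha]
            exact card_units_pow_eq_le hm _
          exact mul_le_mul_of_nonneg_right (Nat.cast_le.mpr hcard) (sq_nonneg _)
      _ = _ := by rw [Finset.mul_sum]
  have hpos : (0 : ℝ) < Fintype.card Fˣ := by exact_mod_cast Fintype.card_pos
  have hga : g a ≤ (m * √(Fintype.card F)) ^ 2 := by
    rw [mul_pow, Real.sq_sqrt (by positivity)]
    refine le_of_mul_le_mul_left (hsum.trans ?_) hpos
    calc _ ≤ (m : ℝ) * ((Fintype.card F : ℝ) * (Fintype.card Fˣ * m)) := by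
          gcongr
          exact sum_norm_sq_sum_units_pow_le hψ hm
      _ = _ := by ring
  exact le_of_sq_le_sq hga (by positivity)

theorem two_mul_pow_le_choose {n k : ℕ} (hk : 0 < k) (hkn : 2 * k ≤ n) :
    (2 * n) ^ k ≤ 2 * k * (n.choose k * k ^ k) := by
  have hdesc : (2 * k).descFactorial k * n ^ k ≤ n.descFactorial k * (2 * k) ^ k := by
    have hpow (c : ℕ) : c ^ k = ∏ i ∈ Finset.range k, c := by simp
    rw [Nat.descFactorial_eq_prod_range, Nat.descFactorial_eq_prod_range, hpow, hpow,
      ← Finset.prod_mul_distrib, ← Finset.prod_mul_distrib]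
    refine Finset.prod_le_prod' fun i hi ↦ ?_
    have hi' := Finset.mem_range.mp hi
    rw [Nat.sub_mul, Nat.sub_mul, mul_comm n]
    exact Nat.sub_le_sub_left (Nat.mul_le_mul_left i hkn) _
  have hchoose : (2 * k).choose k * n ^ k ≤ n.choose k * (2 * k) ^ k := by
    rw [Nat.descFactorial_eq_factorial_mul_choose, Nat.descFactorial_eq_factorial_mul_choose,
      mul_assoc, mul_assoc] at hdesc
    exact Nat.le_of_mul_le_mul_left hdesc k.factorial_pos
  have hcentral := Nat.four_pow_le_two_mul_self_mul_centralBinom k hk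
  rw [Nat.centralBinom] at hcentral
  refine le_of_mul_le_mul_left (a := 2 ^ k) ?_ (by positivity)
  calc 2 ^ k * (2 * n) ^ k = 4 ^ k * n ^ k := by rw [← mul_pow, ← mul_pow]; ring_nf
    _ ≤ 2 * k * (2 * k).choose k * n ^ k := by gcongr
    _ ≤ 2 * k * (n.choose k * (2 * k) ^ k) := by rw [mul_assoc]; gcongr
    _ = _ := by rw [mul_pow]; ring

theorem addChar_sum_eq_prod {ι A R : Type*} [AddCommMonoid A] [CommMonoid R] (ψ : AddChar A R)
    (s : Finset ι) (f : ι → A) : ψ (∑ x ∈ s, f x) = ∏ x ∈ s, ψ (f x) :=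
  map_prod ψ.toMonoidHom (fun x ↦ Multiplicative.ofAdd (f x)) s

/-- If no `k`-element set of units has sum of `m`-th powers equal to `b`, the trivial character
is balanced by the others. -/
theorem choose_le_of_forall_sum_ne {F : Type*} [Field F] [Fintype F] [DecidableEq F]
    {ψ : AddChar F ℂ} (hψ : ψ.IsPrimitive) {m k : ℕ} {b : F} {M : ℝ}
    (hne : ∀ s : Finset Fˣ, s.card = k → ∑ x ∈ s, (x : F) ^ m ≠ b)
    (hM : ∀ a : F, a ≠ 0 →
      ‖∑ s ∈ (Finset.univ : Finset Fˣ).powersetCard k, ∏ x ∈ s, ψ (a * (x : F) ^ m)‖ ≤ M) :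
    ((Fintype.card Fˣ).choose k : ℝ) ≤ Fintype.card Fˣ * M := by
  set E : F → ℂ := fun a ↦
    ∑ s ∈ (Finset.univ : Finset Fˣ).powersetCard k, ∏ x ∈ s, ψ (a * (x : F) ^ m) with hE
  have hzero : ∑ a : F, ψ (-(a * b)) * E a = 0 := by
    simp_rw [hE, Finset.mul_sum]
    rw [Finset.sum_comm]
    refine Finset.sum_eq_zero fun s hs ↦ ?_
    have hs' := hne s (Finset.mem_powersetCard.mp hs).2
    rw [← sub_ne_zero] at hs'
    have h := AddChar.sum_mulShift (∑ x ∈ s, (x : F) ^ m - b) hψ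
    rw [if_neg hs', Nat.cast_zero] at h
    rw [← h]
    refine Finset.sum_congr rfl fun a _ ↦ ?_
    rw [← addChar_sum_eq_prod, ← AddChar.map_add_eq_mul, ← Finset.mul_sum]
    congr 1
    ring
  have hE0 : E 0 = (Fintype.card Fˣ).choose k := by simp [hE]
  rw [← Finset.add_sum_erase _ _ (Finset.mem_univ (0 : F)), zero_mul, neg_zero,
    AddChar.map_zero_eq_one, one_mul, hE0] at hzero
  calc ((Fintype.card Fˣ).choose k : ℝ)
      = ‖∑ a ∈ Finset.univ.erase (0 : F), ψ (-(a * b)) * E a‖ := by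
        rw [eq_neg_of_add_eq_zero_right hzero, norm_neg, Complex.norm_natCast]
    _ ≤ ∑ a ∈ Finset.univ.erase (0 : F), M := by
        refine norm_sum_le_of_le _ fun a ha ↦ ?_
        rw [norm_mul, AddChar.norm_apply, one_mul]
        exact hM a (Finset.ne_of_mem_erase ha)
    _ = _ := by
        rw [Finset.sum_const, nsmul_eq_mul, Finset.card_erase_of_mem (Finset.mem_univ _),
          Finset.card_univ, ← Fintype.card_units]

theorem Nstar_pos_of_sum_eq {F : Type*} [Field F] [Finite F] {m k : ℕ} {b : F} (s : Finset Fˣ)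
    (hs : s.card = k) (hb : ∑ x ∈ s, (x : F) ^ m = b) : 0 < Nstar m k b := by
  let e := s.equivFinOfCardEq hs
  rw [Nstar, Nat.card_pos_iff]
  refine ⟨⟨⟨fun i ↦ ((e.symm i : Fˣ) : F), fun i j hij ↦ ?_, fun i ↦ Units.ne_zero _, ?_⟩⟩,
    inferInstance⟩
  · exact e.symm.injective (Subtype.ext (Units.val_injective hij))
  · rw [← hb, ← Finset.sum_coe_sort s]
    exact Fintype.sum_equiv e.symm _ _ fun i ↦ rfl

/-- The numerical comparison of the main term with the error terms. -/
theorem error_lt_choose {n k : ℕ} (hk : 0 < k) (hkn : 2 * k ≤ n)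
    (hlog : 6 * Real.log (n + 1) < k) {M : ℝ}
    (hM : M * (3 / 2 * k / n) ^ k ≤ Real.exp
      ((n * (3 / 2 * k / n) ^ 2 + 2 * (3 / 2 * k / n) * (1 / 50 * (n + 1))) / 2)) :
    n * M < n.choose k := by
  have hk' : (0 : ℝ) < k := by exact_mod_cast hk
  have hkn' : 2 * (k : ℝ) ≤ n := by exact_mod_cast hkn
  have hn' : (1 : ℝ) ≤ n := by exact_mod_cast (by omega : 1 ≤ n)
  have hn0 : (0 : ℝ) < n := by linarith
  set r : ℝ := 3 / 2 * k / n with hr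
  have hr0 : 0 < r := by positivity
  have hrn : r * n = 3 / 2 * k := div_mul_cancel₀ _ hn0.ne'
  have hr34 : r ≤ 3 / 4 := by rw [hr, div_le_iff₀ hn0]; linarith
  have hexponent : (n * r ^ 2 + 2 * r * (1 / 50 * (n + 1))) / 2 ≤ 5 / 8 * (k : ℝ) := by
    have h1 : n * r ^ 2 ≤ 3 / 2 * k * (3 / 4) := by
      calc n * r ^ 2 = 3 / 2 * k * r := by rw [← hrn]; ring
        _ ≤ _ := by gcongr
    have h2 : r * 1 ≤ r * n := by gcongr
    linarith
  have hsq : ((n : ℝ) + 1) ^ 2 < Real.exp (k / 3) := by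
    rw [← Real.log_lt_iff_lt_exp (by positivity), Real.log_pow]
    push_cast
    linarith
  have hbinom : Real.exp k ≤ 2 * k * (n.choose k * r ^ k) := by
    have h : ((2 : ℝ) * n) ^ k ≤ 2 * k * (n.choose k * k ^ k) := by
      exact_mod_cast two_mul_pow_le_choose hk hkn
    refine le_of_mul_le_mul_right ?_ (by positivity : 0 < (2 * n : ℝ) ^ k)
    calc Real.exp k * (2 * n : ℝ) ^ k ≤ 3 ^ k * (2 * k * (n.choose k * k ^ k)) := by
          gcongr
          rw [← Real.exp_one_pow]
          gcongr
          linarith [Real.exp_one_lt_d9]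
      _ = 2 * k * (n.choose k * (3 * k) ^ k) := by rw [mul_pow]; ring
      _ = 2 * k * (n.choose k * (r * (2 * n)) ^ k) := by
          congr 3
          linarith
      _ = _ := by rw [mul_pow]; ring
  refine lt_of_mul_lt_mul_right ?_ (by positivity : 0 ≤ 2 * k * r ^ k)
  calc n * M * (2 * k * r ^ k) = n * (2 * k) * (M * r ^ k) := by ring
    _ ≤ n * (2 * k) * Real.exp (5 / 8 * k) := by
        gcongr
        exact hM.trans (Real.exp_le_exp.mpr hexponent)
    _ ≤ (n + 1) ^ 2 * Real.exp (5 / 8 * k) := by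
        gcongr
        nlinarith
    _ < Real.exp (k / 3) * Real.exp (5 / 8 * k) := by gcongr
    _ ≤ Real.exp k := by
        rw [← Real.exp_add]
        exact Real.exp_le_exp.mpr (by linarith)
    _ ≤ _ := hbinom.trans_eq (by ring)

theorem exists_constant_diagonal_distinct_positive :
    ∃ c : ℝ, 0 < c ∧ c < 1 ∧
      ∀ (F : Type) [Field F] [Fintype F], 2 < ringChar F →
        ∀ (m : ℕ), 0 < m → m ∣ Fintype.card F - 1 →
          (m : ℝ) < c * Real.sqrt (Fintype.card F) →
          ∀ (k : ℕ) (b : F),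
            6 * Real.log (Fintype.card F) < (k : ℝ) →
            (k : ℝ) ≤ ((Fintype.card F : ℝ) - 1) / 2 →
            0 < Nstar m k b := by
  classical
  refine ⟨1 / 50, by norm_num, by norm_num, ?_⟩
  intro F _ _ _ m hm _ hmc k b hlog hk
  by_contra hN
  have hne : ∀ s : Finset Fˣ, s.card = k → ∑ x ∈ s, (x : F) ^ m ≠ b :=
    fun s hs hb ↦ hN (Nstar_pos_of_sum_eq s hs hb)
  have hq : Fintype.card F = Fintype.card Fˣ + 1 := by
    rw [Fintype.card_units, Nat.sub_add_cancel Fintype.card_pos]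
  set n := Fintype.card Fˣ
  have hqr : (Fintype.card F : ℝ) = n + 1 := by rw [hq]; push_cast; rfl
  have hψ := AddChar.FiniteField.primitiveChar_to_Complex_isPrimitive F
  set ψ := AddChar.FiniteField.primitiveChar_to_Complex F
  rw [hqr] at hlog hk
  have hk0 : 0 < k := by
    have : 0 ≤ Real.log ((n : ℝ) + 1) := Real.log_nonneg (by linarith [n.cast_nonneg (α := ℝ)])
    exact_mod_cast (by linarith : (0 : ℝ) < k)
  have hkn : 2 * k ≤ n := by
    have : (2 * k : ℝ) ≤ n := by linarith
    exact_mod_cast this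
  have hn0 : 0 < n := by omega
  set r : ℝ := 3 / 2 * k / n with hr
  have hr0 : 0 < r := by positivity
  set M : ℝ := Real.exp ((n * r ^ 2 + 2 * r * (1 / 50 * (n + 1))) / 2) / r ^ k
  have hMr : M * r ^ k = Real.exp ((n * r ^ 2 + 2 * r * (1 / 50 * (n + 1))) / 2) :=
    div_mul_cancel₀ _ (by positivity)
  refine (error_lt_choose hk0 hkn hlog hMr.le).not_ge
    (choose_le_of_forall_sum_ne hψ hne fun a ha ↦ ?_)
  refine le_of_mul_le_mul_right (le_of_le_of_eq ?_ hMr.symm) (by positivity : 0 < r ^ k)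
  refine norm_sum_powersetCard_prod_mul_pow_le Finset.univ _ (fun x _ ↦ ψ.norm_apply _) ?_
    hr0.le k
  refine (norm_sum_units_pow_le hψ hm ha).trans ?_
  calc (m : ℝ) * √(Fintype.card F) ≤ 1 / 50 * √(Fintype.card F) * √(Fintype.card F) := by
        gcongr
    _ = 1 / 50 * (n + 1) := by rw [mul_assoc, Real.mul_self_sqrt (by positivity), hqr]
end
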